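/- arXiv:1308.0955 — 8 statements merged into one kernel-verified Lean document; each statement's English description precedes it below -/
import Mathlib

section
/- Let ε = e^{2πi/5} ∈ ℂ. The set of complex roots of the polynomial z¹¹ + 11z⁶ − z (that is, of f(z,1) where f(z₁,z₂) = z₁z₂(z₁¹⁰ + 11z₁⁵z₂⁵ − z₂¹⁰)) is exactly {0} ∪ {ε^ν(ε + ε⁴) : ν = 0,1,2,3,4} ∪ {ε^ν(ε² + ε³) : ν = 0,1,2,3,4}. -/
open Complex

theorem aux_fifth {e a z : ℂ} (he : IsPrimitiveRoot e 5) (ha : a ≠ 0) (h : z ^ 5 = a ^ 5) :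
    ∃ ν : Fin 5, z = e ^ (ν : ℕ) * a := by
  have h1 : (z / a) ^ 5 = 1 := by
    rw [div_pow, h, div_self (pow_ne_zero 5 ha)]
  obtain ⟨i, hi, hh⟩ := he.eq_pow_of_pow_eq_one h1
  refine ⟨⟨i, hi⟩, ?_⟩
  simp only [hh]
  field_simp

/-- The roots of `z¹¹ + 11z⁶ − z = f(z,1)` are `0` together with the 10 finite vertices
`ε^ν(ε + ε⁴)`, `ε^ν(ε² + ε³)` of the icosahedron. -/
theorem icosF_roots :
    {z : ℂ | z ^ 11 + 11 * z ^ 6 - z = 0} =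
      {0} ∪ {z : ℂ | ∃ ν : Fin 5, z = (exp (2 * Real.pi * I / 5)) ^ (ν : ℕ) *
            (exp (2 * Real.pi * I / 5) + exp (2 * Real.pi * I / 5) ^ 4)}
        ∪ {z : ℂ | ∃ ν : Fin 5, z = (exp (2 * Real.pi * I / 5)) ^ (ν : ℕ) *
            (exp (2 * Real.pi * I / 5) ^ 2 + exp (2 * Real.pi * I / 5) ^ 3)} := by
  have he : IsPrimitiveRoot (exp (2 * Real.pi * I / 5)) 5 := by
    have := Complex.isPrimitiveRoot_exp 5 (by norm_num)
    simpa using this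
  generalize exp (2 * Real.pi * I / 5) = e at he
  have h5 : e ^ 5 = 1 := he.pow_eq_one
  have h1 : e ≠ 1 := he.ne_one (by norm_num)
  have hs : 1 + e + e ^ 2 + e ^ 3 + e ^ 4 = 0 := by
    have : (e - 1) * (1 + e + e ^ 2 + e ^ 3 + e ^ 4) = 0 := by linear_combination h5
    exact (mul_eq_zero.mp this).resolve_left (sub_ne_zero.mpr h1)
  obtain ⟨a, ha⟩ : ∃ a, a = e + e ^ 4 := ⟨_, rfl⟩
  obtain ⟨b, hb⟩ : ∃ b, b = e ^ 2 + e ^ 3 := ⟨_, rfl⟩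
  rw [← ha, ← hb]
  have hab : b = -1 - a := by rw [ha, hb]; linear_combination hs
  have hm : a * b = -1 := by
    rw [ha, hb]; linear_combination hs + (e + e ^ 2) * h5
  have ha0 : a ≠ 0 := by rintro rfl; simp at hm
  have hb0 : b ≠ 0 := by intro h; simp [h] at hm
  have hq : a ^ 2 = 1 - a := by rw [hab] at hm; linear_combination -hm
  have ha5 : a ^ 5 = 5 * a - 3 := by
    linear_combination (a ^ 3 - a ^ 2 + 2 * a - 3) * hq
  have hb5 : b ^ 5 = -8 - 5 * a := by
    have hq' : b ^ 2 = 1 - b := by rw [hab]; linear_combination hq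
    have : b ^ 5 = 5 * b - 3 := by
      linear_combination (b ^ 3 - b ^ 2 + 2 * b - 3) * hq'
    rw [this, hab]; ring
  have hfac : ∀ z : ℂ, z ^ 11 + 11 * z ^ 6 - z = z * ((z ^ 5 - a ^ 5) * (z ^ 5 - b ^ 5)) := by
    intro z
    rw [ha5, hb5]
    linear_combination 25 * z * hq
  ext z
  simp only [Set.mem_setOf_eq, Set.mem_union, Set.mem_singleton_iff]
  rw [hfac, mul_eq_zero, mul_eq_zero, sub_eq_zero, sub_eq_zero, or_assoc]
  have hp : ∀ n : ℕ, (e ^ n) ^ 5 = 1 := fun n => by rw [← pow_mul, mul_comm, pow_mul, h5, one_pow]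
  refine or_congr Iff.rfl (or_congr ⟨aux_fifth he ha0, ?_⟩ ⟨aux_fifth he hb0, ?_⟩)
  · rintro ⟨n, rfl⟩; rw [mul_pow, hp, one_mul]
  · rintro ⟨n, rfl⟩; rw [mul_pow, hp, one_mul]
end

section
/- Let ε = e^{2πi/5} ∈ ℂ and let H, T be the icosahedral invariant polynomials. Let p ∈ ℂ[z₁,z₂] be a homogeneous polynomial of degree 60 which is invariant under the two substitutions (z₁,z₂) ↦ (ε³z₁, ε²z₂) and (z₁,z₂) ↦ ((−(ε−ε⁴)z₁ + (ε²−ε³)z₂)/√5, ((ε²−ε³)z₁ + (ε−ε⁴)z₂)/√5). Then p is a ℂ-linear combination of H³ and T². -/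
open Complex MvPolynomial

/-- The degree-20 icosahedral invariant `H`. -/
noncomputable def icosH : MvPolynomial (Fin 2) ℂ :=
  -((X 0) ^ 20 + (X 1) ^ 20) + 228 * ((X 0) ^ 15 * (X 1) ^ 5 - (X 0) ^ 5 * (X 1) ^ 15)
    - 494 * (X 0) ^ 10 * (X 1) ^ 10

/-- The degree-30 icosahedral invariant `T`. -/
noncomputable def icosT : MvPolynomial (Fin 2) ℂ :=
  ((X 0) ^ 30 + (X 1) ^ 30) + 522 * ((X 0) ^ 25 * (X 1) ^ 5 - (X 0) ^ 5 * (X 1) ^ 25)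
    - 10005 * ((X 0) ^ 20 * (X 1) ^ 10 + (X 0) ^ 10 * (X 1) ^ 20)


lemma ico_H_id {R : Type*} [CommRing R] (t z w : R) (ht : t^2 = t + 1) :
   -((z+t*w)^20 + (t*z-w)^20) + 228 * ((z+t*w)^15 * (t*z-w)^5 - (z+t*w)^5*(t*z-w)^15)
     - 494 * (z+t*w)^10 * (t*z-w)^10 = (1+t^2)^10 * (-(z^20+w^20) + 228 * (z^15*w^5-z^5*w^15) - 494*z^10*w^10) := by
  have h3 : t^3 = 2*t+1 := by linear_combination (t+1)*ht
  have h4 : t^4 = 3*t+2 := by linear_combination (t^2+t+2)*ht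
  have h5 : t^5 = 5*t+3 := by linear_combination (t^3+t^2+2*t+3)*ht
  obtain ⟨A, hA⟩ : ∃ A, A = z^5+5*t*z^4*w+10*(t+1)*z^3*w^2+10*(2*t+1)*z^2*w^3+5*(3*t+2)*z*w^4+(5*t+3)*w^5 := ⟨_, rfl⟩
  obtain ⟨B, hB⟩ : ∃ B, B = (5*t+3)*z^5-5*(3*t+2)*z^4*w+10*(2*t+1)*z^3*w^2-10*(t+1)*z^2*w^3+5*t*z*w^4-w^5 := ⟨_, rfl⟩
  have eA : (z+t*w)^5 = A := by
    rw [hA]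
    linear_combination (10*z^3*w^2)*ht+10*z^2*w^3*h3+5*z*w^4*h4+w^5*h5
  have eB : (t*z-w)^5 = B := by
    rw [hB]
    linear_combination (-10*z^2*w^3)*ht+10*z^3*w^2*h3-5*z^4*w*h4+z^5*h5
  have e10 : (1+t^2)^10 = (2+t)^10 := by
    rw [ht]; ring
  have l : -((z+t*w)^20 + (t*z-w)^20) + 228 * ((z+t*w)^15 * (t*z-w)^5 - (z+t*w)^5*(t*z-w)^15)
     - 494 * (z+t*w)^10 * (t*z-w)^10 = -(A^4+B^4)+228*(A^3*B-A*B^3)-494*A^2*B^2 := by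
    rw [← eA, ← eB]; ring
  rw [l, e10, hA, hB]
  clear l e10 eA eB hA hB h3 h4 h5
  grind

open Polynomial in
lemma ico_rep (p : MvPolynomial (Fin 2) ℂ) (h : p.IsHomogeneous 60) :
    ∃ c : ℕ → ℂ, (∀ A B : ℂ[X], MvPolynomial.aeval ![A, B] p =
      ∑ n ∈ Finset.range 61, Polynomial.C (c n) * A ^ n * B ^ (60 - n)) ∧
      ((∀ n ∈ Finset.range 61, c n = 0) → p = 0) := by
  classical
  refine ⟨fun n => MvPolynomial.coeff (Finsupp.single 0 n + Finsupp.single 1 (60 - n)) p, ?_, ?_⟩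
  · intro A B
    rw [MvPolynomial.aeval_def, MvPolynomial.eval₂_eq]
    have hd : ∀ d ∈ p.support, d 0 + d 1 = 60 := by
      intro d hd
      have := h (MvPolynomial.mem_support_iff.mp hd)
      simpa [Finsupp.weight_apply, Finsupp.sum_fintype] using this
    have hd2 : ∀ d : Fin 2 →₀ ℕ, d 0 + d 1 = 60 →
        Finsupp.single 0 (d 0) + Finsupp.single 1 (60 - d 0) = d := by
      intro d hd
      ext i
      fin_cases i
      · simp
      · simp; omega
    refine Finset.sum_of_injOn (fun d => d 0) ?_ ?_ ?_ ?_
    · intro d1 h1 d2 h2 h12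
      rw [← hd2 d1 (hd d1 h1), ← hd2 d2 (hd d2 h2)]
      simp only at h12
      rw [h12]
    · intro d h1
      have := hd d h1
      simp only [Finset.coe_range, Set.mem_Iio]
      omega
    · intro n hn hn2
      have : MvPolynomial.coeff (Finsupp.single 0 n + Finsupp.single 1 (60 - n)) p = 0 := by
        by_contra hne
        apply hn2
        refine ⟨_, Finset.mem_coe.mpr (MvPolynomial.mem_support_iff.mpr hne), ?_⟩
        simp
      simp only [this, map_zero, zero_mul]
    · intro d h1
      have h2 := hd d h1
      have h3 : 60 - d 0 = d 1 := by omega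
      simp only [hd2 d h2]
      rw [h3]
      rw [mul_assoc, ← Polynomial.C_eq_algebraMap]
      congr 1
      rw [Finset.prod_subset (Finset.subset_univ _), Fin.prod_univ_two]
      · simp
      · intro x _ hx
        rw [Finsupp.notMem_support_iff.mp hx, pow_zero]
  · intro hc
    ext d
    rw [MvPolynomial.coeff_zero]
    by_contra hne
    have := h hne
    have h2 : d 0 + d 1 = 60 := by
      simpa [Finsupp.weight_apply, Finsupp.sum_fintype] using this
    apply hne
    have h3 := hc (d 0) (by simp; omega)
    have h4 : Finsupp.single 0 (d 0) + Finsupp.single 1 (60 - d 0) = d := by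
      ext i
      fin_cases i
      · simp
      · simp; omega
    simp only [h4] at h3
    exact h3

open Polynomial in
lemma ico_sum (c : ℕ → ℂ) : ∑ n ∈ Finset.range 61, Polynomial.C (c n) * (1 : ℂ[X]) ^ n * 0 ^ (60 - n) =
    Polynomial.C (c 60) := by
  rw [Finset.sum_eq_single 60]
  · simp
  · intro n hn h1
    have : 60 - n ≠ 0 := by simp at hn; omega
    rw [zero_pow this, mul_zero]
  · simp

open Polynomial in
lemma ico_orb (q : ℂ[X]) (e r : ℂ) (he : IsPrimitiveRoot e 5) (hr : r ≠ 0)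
    (h : ∀ j : ℕ, (Polynomial.X - Polynomial.C (r * e ^ j)) ^ 5 ∣ q) :
    (Polynomial.X ^ 5 - Polynomial.C (r ^ 5)) ^ 5 ∣ q := by
  have h1 : ∏ j ∈ Finset.range 5, (Polynomial.X - Polynomial.C (r * e ^ j)) =
      Polynomial.X ^ 5 - Polynomial.C (r ^ 5) := by
    rw [X_pow_sub_C_eq_prod he (by norm_num) (rfl : r ^ 5 = r ^ 5)]
    refine Finset.prod_congr rfl fun j _ => ?_
    rw [mul_comm]
  rw [← h1, ← Finset.prod_pow]
  refine Finset.prod_dvd_of_coprime ?_ (fun j _ => h j)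
  intro i hi j hj hij
  refine IsCoprime.pow ?_
  refine Polynomial.isCoprime_X_sub_C_of_isUnit_sub ?_
  rw [isUnit_iff_ne_zero, sub_ne_zero]
  intro h2
  exact hij (he.pow_inj (by simpa using hi) (by simpa using hj) (mul_left_cancel₀ hr h2))

noncomputable def icoF : MvPolynomial (Fin 2) ℂ :=
  (X 0 * X 1) * ((X 0) ^ 10 + 11 * ((X 0) ^ 5 * (X 1) ^ 5) - (X 1) ^ 10)

lemma icoF_hom : (icoF ^ 5).IsHomogeneous 60 := by
  have hx := isHomogeneous_X ℂ (0 : Fin 2)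
  have hy := isHomogeneous_X ℂ (1 : Fin 2)
  have h11 : (11 : MvPolynomial (Fin 2) ℂ) = C 11 := (map_ofNat C 11).symm
  have : icoF.IsHomogeneous 12 := by
    unfold icoF
    refine (hx.mul hy).mul (n := 10) (IsHomogeneous.sub (IsHomogeneous.add ?_ ?_) ?_)
    · simpa using hx.pow 10
    · rw [h11]
      simpa using (isHomogeneous_C (Fin 2) (11 : ℂ)).mul ((hx.pow 5).mul (hy.pow 5))
    · simpa using hy.pow 10
  simpa using this.pow 5

open Polynomial in
lemma ico_key (p : MvPolynomial (Fin 2) ℂ) (h : p.IsHomogeneous 60) (e t a : ℂ)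
    (he : IsPrimitiveRoot e 5) (ht : t = -(e + e ^ 4)) (ha : a ≠ 0)
    (hS : ∀ A B : ℂ[X], MvPolynomial.aeval ![Polynomial.C (e ^ 3) * A, Polynomial.C (e ^ 2) * B] p =
      MvPolynomial.aeval ![A, B] p)
    (hT : ∀ A B : ℂ[X], MvPolynomial.aeval ![Polynomial.C a * (A + Polynomial.C t * B),
        Polynomial.C a * (Polynomial.C t * A - B)] p = MvPolynomial.aeval ![A, B] p)
    (hc : MvPolynomial.aeval ![(1 : ℂ[X]), 0] p = 0) :
    ∃ k : ℂ, p = MvPolynomial.C k * icoF ^ 5 := by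
  obtain ⟨c, hc1, hc2⟩ := ico_rep p h
  have hc3 : c 60 = 0 := by
    rw [hc1, ico_sum] at hc
    exact Polynomial.C_eq_zero.mp hc
  have e5 : e ^ 5 = 1 := he.pow_eq_one
  have e0 : e ≠ 0 := he.ne_zero (by norm_num)
  have e1 : e ≠ 1 := he.ne_one (by norm_num)
  have e2 : e ^ 2 ≠ 1 := he.pow_ne_one_of_pos_of_lt (by norm_num) (by norm_num)
  have es : 1 + e + e ^ 2 + e ^ 3 + e ^ 4 = 0 := by
    apply mul_left_cancel₀ (sub_ne_zero.mpr e1)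
    linear_combination e5
  have t2 : t ^ 2 = t + 1 := by
    rw [ht]; linear_combination es + (2 + e ^ 3) * e5 - es + es
  have t0 : t ≠ 0 := by
    rintro rfl; norm_num at t2
  -- coefficients
  have hcoef : ∀ g : ℕ → ℂ, ∀ m ∈ Finset.range 61,
      (∑ n ∈ Finset.range 61, Polynomial.C (g n) * (Polynomial.X : ℂ[X]) ^ n).coeff m = g m := by
    intro g m hm
    simp only [Polynomial.finsetSum_coeff, Polynomial.coeff_C_mul_X_pow]
    rw [Finset.sum_ite_eq]
    simp only [hm, if_true]
  have hq : MvPolynomial.aeval ![(Polynomial.X : ℂ[X]), 1] p =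
      ∑ n ∈ Finset.range 61, Polynomial.C (c n) * (Polynomial.X : ℂ[X]) ^ n := by
    rw [hc1]; simp
  have hc5 : ∀ n ∈ Finset.range 61, ¬ 5 ∣ n → c n = 0 := by
    intro n hn h5
    have h1 := hS Polynomial.X 1
    rw [hq, hc1] at h1
    have h2 : ∑ n ∈ Finset.range 61, Polynomial.C (c n) * (Polynomial.C (e ^ 3) * Polynomial.X) ^ n *
        (Polynomial.C (e ^ 2) * 1) ^ (60 - n) = ∑ n ∈ Finset.range 61,
        Polynomial.C (c n * ((e ^ 3) ^ n * (e ^ 2) ^ (60 - n))) * (Polynomial.X : ℂ[X]) ^ n := by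
      refine Finset.sum_congr rfl fun n _ => ?_
      simp only [Polynomial.C_mul, Polynomial.C_pow]; ring
    rw [h2] at h1
    have h3 := congrArg (fun q => Polynomial.coeff q n) h1
    simp only [hcoef _ n hn] at h3
    have hn' : n ≤ 60 := by simp at hn; omega
    have h4 : (e ^ 3) ^ n * (e ^ 2) ^ (60 - n) = e ^ n := by
      rw [← pow_mul, ← pow_mul, ← pow_add]
      have : 3 * n + 2 * (60 - n) = 5 * 24 + n := by omega
      rw [this, pow_add, pow_mul, e5, one_pow, one_mul]
    rw [h4] at h3
    have h5' : e ^ n ≠ 1 := fun hh => h5 ((he.pow_eq_one_iff_dvd n).mp hh)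
    have h6 : c n * (e ^ n - 1) = 0 := by linear_combination h3
    exact (mul_eq_zero.mp h6).resolve_right (sub_ne_zero.mpr h5')
  have hc55 : ∀ n ∈ Finset.range 61, 55 < n → c n = 0 := by
    intro n hn h1
    by_cases h2 : n = 60
    · rw [h2, hc3]
    · apply hc5 n hn
      simp at hn
      omega
  have hB : ∀ A B : ℂ[X], B ^ 5 ∣ MvPolynomial.aeval ![A, B] p := by
    intro A B
    rw [hc1]
    refine Finset.dvd_sum fun n hn => ?_
    by_cases h1 : 55 < n
    · rw [hc55 n hn h1]; simp
    · exact Dvd.dvd.mul_left (pow_dvd_pow _ (by omega)) _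
  have hrot : ∀ r : ℂ, (∀ A B : ℂ[X], (A - Polynomial.C r * B) ^ 5 ∣ MvPolynomial.aeval ![A, B] p) →
      ∀ j : ℕ, (∀ A B : ℂ[X], (A - Polynomial.C (r * e ^ j) * B) ^ 5 ∣ MvPolynomial.aeval ![A, B] p) := by
    have step : ∀ r : ℂ, (∀ A B : ℂ[X], (A - Polynomial.C r * B) ^ 5 ∣ MvPolynomial.aeval ![A, B] p) →
       (∀ A B : ℂ[X], (A - Polynomial.C (r * e ^ 4) * B) ^ 5 ∣ MvPolynomial.aeval ![A, B] p) := by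
      intro r hr A B
      have h1 := hr (Polynomial.C (e ^ 3) * A) (Polynomial.C (e ^ 2) * B)
      rw [hS] at h1
      refine dvd_trans ?_ h1
      refine pow_dvd_pow_of_dvd ⟨Polynomial.C (e ^ 3), ?_⟩ 5
      have e5' : (Polynomial.C e : ℂ[X]) ^ 5 = 1 := by rw [← Polynomial.C_pow, e5, Polynomial.C_1]
      simp only [Polynomial.C_mul, Polynomial.C_pow]
      linear_combination (Polynomial.C r * B * Polynomial.C e ^ 2) * e5'
    have step2 : ∀ j : ℕ, ∀ r : ℂ, (∀ A B : ℂ[X], (A - Polynomial.C r * B) ^ 5 ∣ MvPolynomial.aeval ![A, B] p) →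
       (∀ A B : ℂ[X], (A - Polynomial.C (r * (e ^ 4) ^ j) * B) ^ 5 ∣ MvPolynomial.aeval ![A, B] p) := by
      intro j
      induction j with
      | zero => intro r hr; simpa using hr
      | succ j ih =>
        intro r hr
        have := step _ (ih r hr)
        rw [pow_succ, ← mul_assoc]
        exact this
    intro r hr j
    have h1 := step2 (4 * j) r hr
    have h2 : (e ^ 4) ^ (4 * j) = e ^ j := by
      rw [← pow_mul]
      have : 4 * (4 * j) = 5 * (3 * j) + j := by ring
      rw [this, pow_add, pow_mul, e5, one_pow, one_mul]
    rw [h2] at h1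
    exact h1
  have hE1 : ∀ A B : ℂ[X], (A - Polynomial.C (t - 1) * B) ^ 5 ∣ MvPolynomial.aeval ![A, B] p := by
    intro A B
    have h1 := hB (Polynomial.C a * (A + Polynomial.C t * B)) (Polynomial.C a * (Polynomial.C t * A - B))
    rw [hT] at h1
    refine dvd_trans ?_ h1
    refine pow_dvd_pow_of_dvd ⟨Polynomial.C (a * t), ?_⟩ 5
    have t2' : (Polynomial.C t : ℂ[X]) ^ 2 = Polynomial.C t + 1 := by
      rw [← Polynomial.C_pow, t2, Polynomial.C_add, Polynomial.C_1]
    simp only [Polynomial.C_mul, Polynomial.C_sub, Polynomial.C_1]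
    linear_combination (Polynomial.C a * B) * t2'
  have hmob : ∀ r r' : ℂ, 1 - r * t ≠ 0 → (1 - r * t) * r' = -(t + r) →
      (∀ A B : ℂ[X], (A - Polynomial.C r * B) ^ 5 ∣ MvPolynomial.aeval ![A, B] p) →
      (∀ A B : ℂ[X], (A - Polynomial.C r' * B) ^ 5 ∣ MvPolynomial.aeval ![A, B] p) := by
    intro r r' _ hr' hr A B
    have h1 := hr (Polynomial.C a * (A + Polynomial.C t * B)) (Polynomial.C a * (Polynomial.C t * A - B))
    rw [hT] at h1
    refine dvd_trans ?_ h1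
    refine pow_dvd_pow_of_dvd ⟨Polynomial.C (a * (1 - r * t)), ?_⟩ 5
    have h2 : (1 - Polynomial.C r * Polynomial.C t) * Polynomial.C r' =
        (-(Polynomial.C t + Polynomial.C r) : ℂ[X]) := by
      have := congrArg (Polynomial.C : ℂ →+* ℂ[X]) hr'
      simpa using this
    simp only [Polynomial.C_mul, Polynomial.C_sub, Polynomial.C_1]
    linear_combination (Polynomial.C a * B) * h2
  have hE2 : ∀ A B : ℂ[X], (A - Polynomial.C (-t) * B) ^ 5 ∣ MvPolynomial.aeval ![A, B] p := by
    have h1 := hmob ((t - 1) * e ^ 2) (-t * e ^ 2) ?_ ?_ (hrot _ hE1 2)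
    · have h2 := hrot _ h1 3
      have : -t * e ^ 2 * e ^ 3 = -t := by linear_combination (-t) * e5
      rwa [this] at h2
    · have : 1 - (t - 1) * e ^ 2 * t = 1 - e ^ 2 := by linear_combination (-e ^ 2) * t2
      rw [this]
      exact sub_ne_zero.mpr e2.symm
    · subst ht
      grind
  have hE0 : ∀ A B : ℂ[X], (A - Polynomial.C 0 * B) ^ 5 ∣ MvPolynomial.aeval ![A, B] p := by
    refine hmob (-t) 0 ?_ (by ring) hE2
    intro h1
    have h2 : t = -2 := by linear_combination h1 - t2
    rw [h2] at t2
    norm_num at t2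
  set q := MvPolynomial.aeval ![(Polynomial.X : ℂ[X]), 1] p with hqdef
  have d0 : (Polynomial.X : ℂ[X]) ^ 5 ∣ q := by simpa using hE0 Polynomial.X 1
  have tm0 : t - 1 ≠ 0 := by
    intro h1
    have h2 : t = 1 := by linear_combination h1
    rw [h2] at t2
    norm_num at t2
  have d1 : (Polynomial.X ^ 5 - Polynomial.C ((t - 1) ^ 5)) ^ 5 ∣ q :=
    ico_orb q e _ he tm0 (fun j => by simpa using hrot _ hE1 j Polynomial.X 1)
  have d2 : (Polynomial.X ^ 5 - Polynomial.C ((-t) ^ 5)) ^ 5 ∣ q :=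
    ico_orb q e _ he (neg_ne_zero.mpr t0) (fun j => by simpa using hrot _ hE2 j Polynomial.X 1)
  have t5 : t ^ 5 = 5 * t + 3 := by linear_combination (t^3+t^2+2*t+3)*t2
  have s5 : (t - 1) ^ 5 = 5 * t - 8 := by
    linear_combination (t^3 - 4 * t^2 + 7 * t - 7)*t2
  have cop12 : IsCoprime (Polynomial.X ^ 5 - Polynomial.C ((t - 1) ^ 5))
      ((Polynomial.X ^ 5 - Polynomial.C ((-t) ^ 5)) : ℂ[X]) := by
    have hne : (-t) ^ 5 - (t - 1) ^ 5 ≠ 0 := by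
      intro h1
      have h2 : t = 1 / 2 := by
        have : (-t) ^ 5 = - t ^ 5 := by ring
        rw [this, t5, s5] at h1
        linear_combination (-1/10) * h1
      rw [h2] at t2
      norm_num at t2
    refine ⟨Polynomial.C ((-t) ^ 5 - (t - 1) ^ 5)⁻¹, -Polynomial.C ((-t) ^ 5 - (t - 1) ^ 5)⁻¹, ?_⟩
    have : Polynomial.C ((-t) ^ 5 - (t - 1) ^ 5)⁻¹ * (Polynomial.C ((-t) ^ 5) - Polynomial.C ((t - 1) ^ 5)) = (1 : ℂ[X]) := by
      rw [← Polynomial.C_sub, ← Polynomial.C_mul, inv_mul_cancel₀ hne, Polynomial.C_1]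
    linear_combination this
  have copX : ∀ r : ℂ, r ≠ 0 → IsCoprime (Polynomial.X : ℂ[X]) (Polynomial.X ^ 5 - Polynomial.C r) := by
    intro r hr
    refine ⟨Polynomial.C r⁻¹ * Polynomial.X ^ 4, -Polynomial.C r⁻¹, ?_⟩
    have : Polynomial.C r⁻¹ * Polynomial.C r = (1 : ℂ[X]) := by
      rw [← Polynomial.C_mul, inv_mul_cancel₀ hr, Polynomial.C_1]
    linear_combination this
  have d12 := (cop12.pow (m := 5) (n := 5)).mul_dvd d1 d2
  have d012 := (IsCoprime.mul_right ((copX _ (pow_ne_zero 5 tm0)).pow (m := 5) (n := 5))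
    ((copX _ (pow_ne_zero 5 (neg_ne_zero.mpr t0))).pow (m := 5) (n := 5))).mul_dvd d0 d12
  set W : ℂ[X] := Polynomial.X ^ 5 * ((Polynomial.X ^ 5 - Polynomial.C ((t - 1) ^ 5)) ^ 5 *
    (Polynomial.X ^ 5 - Polynomial.C ((-t) ^ 5)) ^ 5) with hW
  have hWm : W.Monic := by
    rw [hW]
    exact (Polynomial.monic_X_pow 5).mul
      (((Polynomial.monic_X_pow_sub_C _ (by norm_num)).pow 5).mul
      ((Polynomial.monic_X_pow_sub_C _ (by norm_num)).pow 5))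
  have hWd : W.natDegree = 55 := by
    rw [hW, Polynomial.Monic.natDegree_mul (Polynomial.monic_X_pow 5)
      (((Polynomial.monic_X_pow_sub_C _ (by norm_num)).pow 5).mul
      ((Polynomial.monic_X_pow_sub_C _ (by norm_num)).pow 5)),
      Polynomial.Monic.natDegree_mul ((Polynomial.monic_X_pow_sub_C _ (by norm_num)).pow 5)
      ((Polynomial.monic_X_pow_sub_C _ (by norm_num)).pow 5), Polynomial.natDegree_pow,
      Polynomial.natDegree_pow, Polynomial.natDegree_pow, Polynomial.natDegree_X_pow_sub_C,
      Polynomial.natDegree_X_pow_sub_C, Polynomial.natDegree_X]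
  have hqd : q.natDegree ≤ 55 := by
    rw [hq]
    refine Polynomial.natDegree_sum_le_of_forall_le _ _ fun n hn => ?_
    by_cases h1 : 55 < n
    · rw [hc55 n hn h1]; simp
    · exact (Polynomial.natDegree_C_mul_X_pow_le _ _).trans (by omega)
  obtain ⟨g, hg⟩ := d012
  have hg0 : g.natDegree = 0 := by
    by_cases hz : g = 0
    · simp [hz]
    · have := hWm.natDegree_mul' hz
      rw [← hg, hWd] at this
      omega
  rw [Polynomial.eq_C_of_natDegree_eq_zero hg0] at hg
  refine ⟨g.coeff 0, ?_⟩
  rw [← sub_eq_zero]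
  have hhom : (p - MvPolynomial.C (g.coeff 0) * icoF ^ 5).IsHomogeneous 60 := by
    refine h.sub ?_
    simpa using (MvPolynomial.isHomogeneous_C (Fin 2) (g.coeff 0)).mul icoF_hom
  obtain ⟨c', h1, h2⟩ := ico_rep _ hhom
  apply h2
  have hWF : MvPolynomial.aeval ![(Polynomial.X : ℂ[X]), 1] (icoF ^ 5) = W := by
    have s5' : Polynomial.C ((t - 1) ^ 5) = 5 * Polynomial.C t - (8 : ℂ[X]) := by
      rw [s5, Polynomial.C_sub, Polynomial.C_mul]; rfl
    have t5' : Polynomial.C ((-t) ^ 5) = -5 * Polynomial.C t - (3 : ℂ[X]) := by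
      have : (-t) ^ 5 = -5 * t - 3 := by linear_combination - t5
      rw [this, Polynomial.C_sub, Polynomial.C_mul, Polynomial.C_neg]; rfl
    have t2' : (Polynomial.C t : ℂ[X]) ^ 2 = Polynomial.C t + 1 := by
      rw [← Polynomial.C_pow, t2, Polynomial.C_add, Polynomial.C_1]
    rw [hW, s5', t5', ← mul_pow, ← mul_pow, map_pow]
    congr 1
    simp only [icoF, map_mul, map_add, map_sub, map_pow, MvPolynomial.aeval_X, map_ofNat,
      Matrix.cons_val_zero, Matrix.cons_val_one]
    linear_combination (25 * Polynomial.X) * t2'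
  have h3 := h1 Polynomial.X 1
  rw [map_sub, map_mul, hWF, ← hqdef, hg, MvPolynomial.aeval_C] at h3
  have h4 : (0 : ℂ[X]) = ∑ n ∈ Finset.range 61, Polynomial.C (c' n) * (Polynomial.X : ℂ[X]) ^ n := by
    rw [← Polynomial.C_eq_algebraMap] at h3
    have : W * Polynomial.C (g.coeff 0) - Polynomial.C (g.coeff 0) * W = 0 := by ring
    rw [this] at h3
    simpa using h3
  intro n hn
  rw [← hcoef c' n hn, ← h4, Polynomial.coeff_zero]

lemma icosH_hom : (icosH ^ 3).IsHomogeneous 60 := by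
  have hx := isHomogeneous_X ℂ (0 : Fin 2)
  have hy := isHomogeneous_X ℂ (1 : Fin 2)
  have h1 : (228 : MvPolynomial (Fin 2) ℂ) = C 228 := (map_ofNat C 228).symm
  have h2 : (494 : MvPolynomial (Fin 2) ℂ) = C 494 := (map_ofNat C 494).symm
  have : icosH.IsHomogeneous 20 := by
    unfold icosH
    refine IsHomogeneous.sub (IsHomogeneous.add (IsHomogeneous.neg (IsHomogeneous.add ?_ ?_)) ?_) ?_
    · simpa using hx.pow 20
    · simpa using hy.pow 20
    · rw [h1]
      have h3 := (hx.pow 15).mul (hy.pow 5)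
      have h4 := (hx.pow 5).mul (hy.pow 15)
      norm_num at h3 h4
      simpa using (isHomogeneous_C (Fin 2) (228 : ℂ)).mul (h3.sub h4)
    · rw [h2, mul_assoc]
      simpa using (isHomogeneous_C (Fin 2) (494 : ℂ)).mul ((hx.pow 10).mul (hy.pow 10))
  simpa using this.pow 3

lemma icosH_aeval {R : Type*} [CommRing R] [Algebra ℂ R] (A B : R) :
    aeval ![A, B] icosH = -(A^20+B^20) + 228 * (A^15*B^5-A^5*B^15) - 494*A^10*B^10 := by
  simp [icosH]

lemma ico_rel : icosT ^ 2 + icosH ^ 3 = C 1728 * icoF ^ 5 := by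
  have h : (C 1728 : MvPolynomial (Fin 2) ℂ) = 1728 := map_ofNat C 1728
  rw [h]
  unfold icosT icosH icoF
  generalize (X 0 : MvPolynomial (Fin 2) ℂ) = x
  generalize (X 1 : MvPolynomial (Fin 2) ℂ) = y
  ring

open Polynomial in
lemma ico_main (p : MvPolynomial (Fin 2) ℂ) (h : p.IsHomogeneous 60) (e t a : ℂ)
    (he : IsPrimitiveRoot e 5) (ht : t = -(e + e ^ 4)) (t2 : t ^ 2 = t + 1)
    (ha : a ^ 2 * (1 + t ^ 2) = -1)
    (hS : ∀ A B : ℂ[X], MvPolynomial.aeval ![Polynomial.C (e ^ 3) * A, Polynomial.C (e ^ 2) * B] p =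
      MvPolynomial.aeval ![A, B] p)
    (hT : ∀ A B : ℂ[X], MvPolynomial.aeval ![Polynomial.C a * (A + Polynomial.C t * B),
        Polynomial.C a * (Polynomial.C t * A - B)] p = MvPolynomial.aeval ![A, B] p) :
    ∃ a b : ℂ, p = MvPolynomial.C a * icosH ^ 3 + MvPolynomial.C b * icosT ^ 2 := by
  obtain ⟨c, hc1, -⟩ := ico_rep p h
  have ha0 : a ≠ 0 := by
    rintro rfl; norm_num at ha
  have HS : ∀ A B : ℂ[X], MvPolynomial.aeval ![Polynomial.C (e ^ 3) * A, Polynomial.C (e ^ 2) * B] icosH =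
      MvPolynomial.aeval ![A, B] icosH := by
    intro A B
    have e5 : (Polynomial.C e : ℂ[X]) ^ 5 = 1 := by
      rw [← Polynomial.C_pow, he.pow_eq_one, Polynomial.C_1]
    have hx : (Polynomial.C (e ^ 3) * A) ^ 5 = A ^ 5 := by
      rw [Polynomial.C_pow, mul_pow, ← pow_mul, mul_comm 3 5, pow_mul, e5, one_pow, one_mul]
    have hy : (Polynomial.C (e ^ 2) * B) ^ 5 = B ^ 5 := by
      rw [Polynomial.C_pow, mul_pow, ← pow_mul, mul_comm 2 5, pow_mul, e5, one_pow, one_mul]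
    have key : ∀ x y : ℂ[X], -(x^20+y^20) + 228 * (x^15*y^5-x^5*y^15) - 494*x^10*y^10 =
      -((x^5)^4+(y^5)^4) + 228 * ((x^5)^3*y^5-x^5*(y^5)^3) - 494*(x^5)^2*(y^5)^2 := by
      intro x y; ring
    rw [icosH_aeval, icosH_aeval, key, hx, hy, ← key]
  have HT : ∀ A B : ℂ[X], MvPolynomial.aeval ![Polynomial.C a * (A + Polynomial.C t * B),
        Polynomial.C a * (Polynomial.C t * A - B)] icosH = MvPolynomial.aeval ![A, B] icosH := by
    intro A B
    have t2' : (Polynomial.C t : ℂ[X]) ^ 2 = Polynomial.C t + 1 := by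
      rw [← Polynomial.C_pow, t2, Polynomial.C_add, Polynomial.C_1]
    have ha' : (Polynomial.C a : ℂ[X]) ^ 20 * (1 + Polynomial.C t ^ 2) ^ 10 = 1 := by
      have : a ^ 20 * (1 + t ^ 2) ^ 10 = 1 := by
        have : a ^ 20 * (1 + t ^ 2) ^ 10 = (a ^ 2 * (1 + t ^ 2)) ^ 10 := by ring
        rw [this, ha]; norm_num
      have := congrArg (Polynomial.C : ℂ →+* ℂ[X]) this
      simpa using this
    have key : ∀ s x y : ℂ[X], -((s*x)^20+(s*y)^20) + 228 * ((s*x)^15*(s*y)^5-(s*x)^5*(s*y)^15) - 494*(s*x)^10*(s*y)^10 =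
      s ^ 20 * (-(x^20+y^20) + 228 * (x^15*y^5-x^5*y^15) - 494*x^10*y^10) := by
      intro s x y; ring
    rw [icosH_aeval, icosH_aeval, key, ico_H_id _ _ _ t2', ← mul_assoc, ha', one_mul]
  obtain ⟨k, hk⟩ := ico_key (p + MvPolynomial.C (c 60) * icosH ^ 3) (by
      refine h.add ?_
      simpa using (MvPolynomial.isHomogeneous_C (Fin 2) (c 60)).mul icosH_hom) e t a he ht ha0
    (by intro A B; simp only [map_add, map_mul, map_pow _ icosH, HS, MvPolynomial.aeval_C, hS])
    (by intro A B; simp only [map_add, map_mul, map_pow _ icosH, HT, MvPolynomial.aeval_C, hT])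
    (by
      rw [map_add, map_mul, map_pow, icosH_aeval, hc1, ico_sum, MvPolynomial.aeval_C,
        ← Polynomial.C_eq_algebraMap]
      ring)
  refine ⟨k / 1728 - c 60, k / 1728, ?_⟩
  have h1 : (MvPolynomial.C k : MvPolynomial (Fin 2) ℂ) = MvPolynomial.C (k / 1728) * MvPolynomial.C 1728 := by
    rw [← MvPolynomial.C_mul]; congr 1; ring
  rw [h1, mul_assoc, ← ico_rel] at hk
  rw [MvPolynomial.C_sub]
  linear_combination hk

/-- Any homogeneous degree-60 polynomial invariant under the icosahedral group is a linear
combination of `H³` and `T²`. -/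
theorem degree60_invariants (p : MvPolynomial (Fin 2) ℂ)
    (hhom : p.IsHomogeneous 60)
    (hS : aeval (R := ℂ)
      ![C (exp (2 * Real.pi * I / 5) ^ 3) * X 0,
        C (exp (2 * Real.pi * I / 5) ^ 2) * X 1] p = p)
    (hT : aeval (R := ℂ)
      ![C (-(exp (2 * Real.pi * I / 5) - exp (2 * Real.pi * I / 5) ^ 4) /
            (Real.sqrt 5 : ℂ)) * X 0 +
        C ((exp (2 * Real.pi * I / 5) ^ 2 - exp (2 * Real.pi * I / 5) ^ 3) /
            (Real.sqrt 5 : ℂ)) * X 1,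
        C ((exp (2 * Real.pi * I / 5) ^ 2 - exp (2 * Real.pi * I / 5) ^ 3) /
            (Real.sqrt 5 : ℂ)) * X 0 +
        C ((exp (2 * Real.pi * I / 5) - exp (2 * Real.pi * I / 5) ^ 4) /
            (Real.sqrt 5 : ℂ)) * X 1] p = p) :
    ∃ a b : ℂ, p = C a * icosH ^ 3 + C b * icosT ^ 2 := by
  set e := exp (2 * Real.pi * I / 5) with hedef
  have he : IsPrimitiveRoot e 5 := by
    have := Complex.isPrimitiveRoot_exp 5 (by norm_num)
    simpa [hedef] using this
  have e5 : e ^ 5 = 1 := he.pow_eq_one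
  have e1 : e ≠ 1 := he.ne_one (by norm_num)
  have es : 1 + e + e ^ 2 + e ^ 3 + e ^ 4 = 0 := by
    apply mul_left_cancel₀ (sub_ne_zero.mpr e1)
    linear_combination e5
  have s2 : (Real.sqrt 5 : ℂ) ^ 2 = 5 := by
    rw [← Complex.ofReal_pow, Real.sq_sqrt (by norm_num)]; norm_num
  have s0 : (Real.sqrt 5 : ℂ) ≠ 0 := by
    intro h; rw [h] at s2; norm_num at s2
  set s := (Real.sqrt 5 : ℂ) with hs
  have hb : (e ^ 2 - e ^ 3) / s = -(e - e ^ 4) / s * (-(e + e ^ 4)) := by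
    rw [div_mul_eq_mul_div]
    congr 1
    linear_combination e ^ 3 * e5
  have hna : (e - e ^ 4) / s = - (-(e - e ^ 4) / s) := by ring
  rw [hb, hna] at hT
  have ha : (-(e - e ^ 4) / s) ^ 2 * (1 + (-(e + e ^ 4)) ^ 2) = -1 := by
    rw [div_pow, s2]
    grind
  generalize -(e - e ^ 4) / s = a at hT ha
  refine ico_main p hhom e (-(e + e ^ 4)) a he rfl ?_ ha ?_ ?_
  · linear_combination es + (2 + e ^ 3) * e5
  · intro A B
    have h := congrArg (aeval (R := ℂ) ![A, B]) hS
    rw [← h, ← AlgHom.comp_apply, comp_aeval]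
    congr 2
    funext i
    fin_cases i <;> simp [← Polynomial.C_eq_algebraMap]
  · intro A B
    have h := congrArg (aeval (R := ℂ) ![A, B]) hT
    rw [← h, ← AlgHom.comp_apply, comp_aeval]
    congr 2
    funext i
    fin_cases i <;> simp [← Polynomial.C_eq_algebraMap] <;> ring
end

section
/- Let ε = e^{2πi/5} ∈ ℂ. For λ₁, λ₂, μ₁, μ₂ ∈ ℂ, define y_ν = ε^{4ν}λ₁μ₁ − ε^{3ν}λ₂μ₁ + ε^{2ν}λ₁μ₂ + ε^{ν}λ₂μ₂ for ν = 0,1,2,3,4, and define α = −λ₁³μ₁²μ₂ − λ₁²λ₂μ₂³ − λ₁λ₂²μ₁³ + λ₂³μ₁μ₂², β = −λ₁⁴μ₁μ₂³ + λ₁³λ₂μ₁⁴ + 3λ₁²λ₂²μ₁²μ₂² − λ₁λ₂³μ₂⁴ + λ₂⁴μ₁³μ₂, γ = −λ₁⁵(μ₁⁵ + μ₂⁵) + 10λ₁⁴λ₂μ₁³μ₂² − 10λ₁³λ₂²μ₁μ₂⁴ − 10λ₁²λ₂³μ₁⁴μ₂ − 10λ₁λ₂⁴μ₁²μ₂³ +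 λ₂⁵(μ₁⁵ − μ₂⁵). Then ∏_{ν=0}^{4}(X − y_ν) = X⁵ + 5αX² + 5βX + γ as polynomials in X; in particular ∑_ν y_ν = 0 and ∑_ν y_ν² = 0. -/
open Complex Polynomial

lemma pair_aux {R : Type*} [CommRing R] (e x a b c d : R) (h5 : e ^ 5 = 1) :
    (x - (e ^ 4 * a + e ^ 3 * b + e ^ 2 * c + e * d)) *
      (x - (e * a + e ^ 2 * b + e ^ 3 * c + e ^ 4 * d)) =
    x ^ 2 + a ^ 2 + b ^ 2 + c ^ 2 + d ^ 2
      + (e + e ^ 4) * (a * b + b * c + c * d - x * (a + d))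
      + (e ^ 2 + e ^ 3) * (a * c + b * d + a * d - x * (b + c)) := by
  linear_combination (a ^ 2 + b ^ 2 + c ^ 2 + d ^ 2 + e * (a * b + b * c + c * d)
    + e ^ 2 * (a * c + b * d) + e ^ 3 * a * d) * h5

lemma prod_aux {R : Type*} [CommRing R] (e x a b c d : R) (h5 : e ^ 5 = 1)
    (h : 1 + e + e ^ 2 + e ^ 3 + e ^ 4 = 0) :
    (x - (a + b + c + d)) *
    (x - (e ^ 4 * a + e ^ 3 * b + e ^ 2 * c + e * d)) *
    (x - (e ^ 3 * a + e * b + e ^ 4 * c + e ^ 2 * d)) *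
    (x - (e ^ 2 * a + e ^ 4 * b + e * c + e ^ 3 * d)) *
    (x - (e * a + e ^ 2 * b + e ^ 3 * c + e ^ 4 * d)) =
    (x - (a + b + c + d)) *
    ((x ^ 2 + a ^ 2 + b ^ 2 + c ^ 2 + d ^ 2) ^ 2
     - (x ^ 2 + a ^ 2 + b ^ 2 + c ^ 2 + d ^ 2) *
       ((a * b + b * c + c * d - x * (a + d)) + (a * c + b * d + a * d - x * (b + c)))
     - (a * b + b * c + c * d - x * (a + d)) ^ 2 - (a * c + b * d + a * d - x * (b + c)) ^ 2
     + 3 * (a * b + b * c + c * d - x * (a + d)) * (a * c + b * d + a * d - x * (b + c))) := by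
  have h1 := pair_aux e x a b c d h5
  have h2 : (x - (e ^ 3 * a + e * b + e ^ 4 * c + e ^ 2 * d)) *
      (x - (e ^ 2 * a + e ^ 4 * b + e * c + e ^ 3 * d)) =
      x ^ 2 + a ^ 2 + b ^ 2 + c ^ 2 + d ^ 2
      + (e ^ 2 + e ^ 3) * (a * b + b * c + c * d - x * (a + d))
      + (e + e ^ 4) * (a * c + b * d + a * d - x * (b + c)) := by
    have := pair_aux (e ^ 2) x a b c d (by linear_combination (e ^ 5 + 1) * h5)
    have e8 : (e ^ 2) ^ 4 = e ^ 3 := by linear_combination e ^ 3 * h5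
    have e6 : (e ^ 2) ^ 3 = e := by linear_combination e * h5
    have e4 : (e ^ 2) ^ 2 = e ^ 4 := by ring
    rw [e8, e6, e4] at this
    linear_combination this
  have hst : (e + e ^ 4) * (e ^ 2 + e ^ 3) = -1 := by
    linear_combination h + (e + e ^ 2) * h5
  generalize a * b + b * c + c * d - x * (a + d) = P at *
  generalize a * c + b * d + a * d - x * (b + c) = Q at *
  generalize x ^ 2 + a ^ 2 + b ^ 2 + c ^ 2 + d ^ 2 = N at *
  obtain ⟨s, hs⟩ : ∃ s, s = e + e ^ 4 := ⟨_, rfl⟩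
  have ht : e ^ 2 + e ^ 3 = -1 - s := by rw [hs]; linear_combination h
  rw [ht, ← hs] at h1 h2 hst
  have key : (N + s * P + (-1 - s) * Q) * (N + (-1 - s) * P + s * Q) =
      N ^ 2 - N * (P + Q) - P ^ 2 - Q ^ 2 + 3 * P * Q := by
    linear_combination (P - Q) ^ 2 * hst
  rw [← key, ← h1, ← h2]
  ring

/-- Parametrization of the canonical quintic by the doubly-ruled quadric: with
`y_ν = ε^{4ν}λ₁μ₁ − ε^{3ν}λ₂μ₁ + ε^{2ν}λ₁μ₂ + ε^{ν}λ₂μ₂`, the monic polynomial with roots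
`y_0,…,y_4` is `X⁵ + 5αX² + 5βX + γ`; in particular `∑ y_ν = 0` and `∑ y_ν² = 0`. -/
theorem quintic_parametrization (l₁ l₂ m₁ m₂ : ℂ) :
    letI ε : ℂ := exp (2 * Real.pi * I / 5)
    letI y : Fin 5 → ℂ := fun ν =>
      ε ^ (4 * (ν : ℕ)) * l₁ * m₁ - ε ^ (3 * (ν : ℕ)) * l₂ * m₁
        + ε ^ (2 * (ν : ℕ)) * l₁ * m₂ + ε ^ (ν : ℕ) * l₂ * m₂
    letI α : ℂ := -l₁ ^ 3 * m₁ ^ 2 * m₂ - l₁ ^ 2 * l₂ * m₂ ^ 3 - l₁ * l₂ ^ 2 * m₁ ^ 3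
        + l₂ ^ 3 * m₁ * m₂ ^ 2
    letI β : ℂ := -l₁ ^ 4 * m₁ * m₂ ^ 3 + l₁ ^ 3 * l₂ * m₁ ^ 4
        + 3 * l₁ ^ 2 * l₂ ^ 2 * m₁ ^ 2 * m₂ ^ 2 - l₁ * l₂ ^ 3 * m₂ ^ 4 + l₂ ^ 4 * m₁ ^ 3 * m₂
    letI γ : ℂ := -l₁ ^ 5 * (m₁ ^ 5 + m₂ ^ 5) + 10 * l₁ ^ 4 * l₂ * m₁ ^ 3 * m₂ ^ 2
        - 10 * l₁ ^ 3 * l₂ ^ 2 * m₁ * m₂ ^ 4 - 10 * l₁ ^ 2 * l₂ ^ 3 * m₁ ^ 4 * m₂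
        - 10 * l₁ * l₂ ^ 4 * m₁ ^ 2 * m₂ ^ 3 + l₂ ^ 5 * (m₁ ^ 5 - m₂ ^ 5)
    (∏ ν, (X - C (y ν)) = X ^ 5 + C (5 * α) * X ^ 2 + C (5 * β) * X + C γ) ∧
      (∑ ν, y ν = 0) ∧ (∑ ν, (y ν) ^ 2 = 0) := by
  have hp := Complex.isPrimitiveRoot_exp 5 (by norm_num)
  have he : exp (2 * Real.pi * I / 5) = exp (2 * Real.pi * I / ((5 : ℕ) : ℂ)) := by norm_num
  have h5 := hp.pow_eq_one
  have h := hp.geom_sum_eq_zero (by norm_num)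
  rw [← he] at h5 h
  clear hp he
  generalize exp (2 * Real.pi * I / 5) = ε at *
  replace h : 1 + ε + ε ^ 2 + ε ^ 3 + ε ^ 4 = 0 := by
    simpa [Finset.sum_range_succ] using h
  set y : Fin 5 → ℂ := fun ν =>
      ε ^ (4 * (ν : ℕ)) * l₁ * m₁ - ε ^ (3 * (ν : ℕ)) * l₂ * m₁
        + ε ^ (2 * (ν : ℕ)) * l₁ * m₂ + ε ^ (ν : ℕ) * l₂ * m₂ with hy
  have y0 : y 0 = l₁ * m₁ - l₂ * m₁ + l₁ * m₂ + l₂ * m₂ := by simp [y]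
  have y1 : y 1 = ε ^ 4 * (l₁ * m₁) + ε ^ 3 * (-(l₂ * m₁)) + ε ^ 2 * (l₁ * m₂)
      + ε * (l₂ * m₂) := by
    change ε ^ 4 * l₁ * m₁ - ε ^ 3 * l₂ * m₁ + ε ^ 2 * l₁ * m₂ + ε ^ 1 * l₂ * m₂ = _
    ring
  have y2 : y 2 = ε ^ 3 * (l₁ * m₁) + ε * (-(l₂ * m₁)) + ε ^ 4 * (l₁ * m₂)
      + ε ^ 2 * (l₂ * m₂) := by
    change ε ^ 8 * l₁ * m₁ - ε ^ 6 * l₂ * m₁ + ε ^ 4 * l₁ * m₂ + ε ^ 2 * l₂ * m₂ = _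
    linear_combination (ε ^ 3 * l₁ * m₁ - ε * l₂ * m₁) * h5
  have y3 : y 3 = ε ^ 2 * (l₁ * m₁) + ε ^ 4 * (-(l₂ * m₁)) + ε * (l₁ * m₂)
      + ε ^ 3 * (l₂ * m₂) := by
    change ε ^ 12 * l₁ * m₁ - ε ^ 9 * l₂ * m₁ + ε ^ 6 * l₁ * m₂ + ε ^ 3 * l₂ * m₂ = _
    linear_combination ((ε ^ 7 + ε ^ 2) * l₁ * m₁ - ε ^ 4 * l₂ * m₁ + ε * l₁ * m₂) * h5
  have y4 : y 4 = ε * (l₁ * m₁) + ε ^ 2 * (-(l₂ * m₁)) + ε ^ 3 * (l₁ * m₂)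
      + ε ^ 4 * (l₂ * m₂) := by
    change ε ^ 16 * l₁ * m₁ - ε ^ 12 * l₂ * m₁ + ε ^ 8 * l₁ * m₂ + ε ^ 4 * l₂ * m₂ = _
    linear_combination ((ε ^ 11 + ε ^ 6 + ε) * l₁ * m₁ - (ε ^ 7 + ε ^ 2) * l₂ * m₁
      + ε ^ 3 * l₁ * m₂) * h5
  refine ⟨?_, ?_, ?_⟩
  · have H := prod_aux (C ε) (X : ℂ[X]) (C (l₁ * m₁)) (C (-(l₂ * m₁))) (C (l₁ * m₂))
      (C (l₂ * m₂)) (by rw [← C_pow, h5, C_1])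
      (by simpa using congrArg (C : ℂ → ℂ[X]) h)
    rw [Fin.prod_univ_five, y0, y1, y2, y3, y4]
    have c5 : (C (5 : ℂ) : ℂ[X]) = 5 := rfl
    have c3 : (C (3 : ℂ) : ℂ[X]) = 3 := rfl
    have c10 : (C (10 : ℂ) : ℂ[X]) = 10 := rfl
    simp only [C_add, C_mul, C_pow, C_neg, C_sub, c5, c3, c10] at H ⊢
    linear_combination H
  · rw [Fin.sum_univ_five]
    change y 0 + y 1 + y 2 + y 3 + y 4 = 0
    rw [y0, y1, y2, y3, y4]
    linear_combination (l₁ * m₁ - l₂ * m₁ + l₁ * m₂ + l₂ * m₂) * h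
  · rw [Fin.sum_univ_five]
    change y 0 ^ 2 + y 1 ^ 2 + y 2 ^ 2 + y 3 ^ 2 + y 4 ^ 2 = 0
    rw [y0, y1, y2, y3, y4]
    linear_combination
      ((l₁ * m₁) ^ 2 + (l₂ * m₁) ^ 2 + (l₁ * m₂) ^ 2 + (l₂ * m₂) ^ 2) * (h + (ε + ε ^ 3) * h5)
      + 2 * (-(l₁ * m₁) * (l₂ * m₁) + (l₁ * m₁) * (l₁ * m₂) - (l₂ * m₁) * (l₂ * m₂)
        + (l₁ * m₂) * (l₂ * m₂)) * (h + (ε + ε ^ 2) * h5)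
end

section
/- In the polynomial ring ℚ[a,b,c], define X = a⁴ − b³ + abc, Y = c⁴ + 40a²bc² − 192a⁵c − 120ab³c + 640a⁴b² − 144b⁵, W = c⁶ + 60a²bc⁴ + 576a⁵c³ − 180ab³c³ + 648b⁵c² − 2760a⁴b²c² + 7200a⁷bc − 1728a¹⁰ + 9360a³b⁴c − 2080a⁶b³ − 16200a²b⁶, D = 108a⁵c − 135a⁴b² + 90a²bc² − 320ab³c + 256b⁵ + c⁴, P = 12³X⁵ + 12⁻³Y³ − 12⁻³W², and Q = (−8a⁵c − 40a⁴b² + 10a²bc² + 45ab³c − 81b⁵ − c⁴)·(64a¹⁰ + 40a⁷bc − 160a⁶b³ + a⁵c³ − 5a⁴b²c² + 5a³b⁴c − 25a²b⁶ − b⁵c²). Then P² − 4X⁵Y³ = D·Q². -/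
open MvPolynomial

namespace Stmt11

/-- `X = a⁴ − b³ + abc` (with `a = X 0`, `b = X 1`, `c = X 2`). -/
noncomputable def XX : MvPolynomial (Fin 3) ℚ :=
  (X 0) ^ 4 - (X 1) ^ 3 + X 0 * X 1 * X 2

/-- `Y = c⁴ + 40a²bc² − 192a⁵c − 120ab³c + 640a⁴b² − 144b⁵`. -/
noncomputable def YY : MvPolynomial (Fin 3) ℚ :=
  (X 2) ^ 4 + 40 * (X 0) ^ 2 * X 1 * (X 2) ^ 2 - 192 * (X 0) ^ 5 * X 2
    - 120 * X 0 * (X 1) ^ 3 * X 2 + 640 * (X 0) ^ 4 * (X 1) ^ 2 - 144 * (X 1) ^ 5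

/-- `W = c⁶ + 60a²bc⁴ + 576a⁵c³ − 180ab³c³ + 648b⁵c² − 2760a⁴b²c² + 7200a⁷bc − 1728a¹⁰
  + 9360a³b⁴c − 2080a⁶b³ − 16200a²b⁶`. -/
noncomputable def WW : MvPolynomial (Fin 3) ℚ :=
  (X 2) ^ 6 + 60 * (X 0) ^ 2 * X 1 * (X 2) ^ 4 + 576 * (X 0) ^ 5 * (X 2) ^ 3
    - 180 * X 0 * (X 1) ^ 3 * (X 2) ^ 3 + 648 * (X 1) ^ 5 * (X 2) ^ 2
    - 2760 * (X 0) ^ 4 * (X 1) ^ 2 * (X 2) ^ 2 + 7200 * (X 0) ^ 7 * X 1 * X 2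
    - 1728 * (X 0) ^ 10 + 9360 * (X 0) ^ 3 * (X 1) ^ 4 * X 2
    - 2080 * (X 0) ^ 6 * (X 1) ^ 3 - 16200 * (X 0) ^ 2 * (X 1) ^ 6

/-- The discriminant `D = 108a⁵c − 135a⁴b² + 90a²bc² − 320ab³c + 256b⁵ + c⁴`. -/
noncomputable def DD : MvPolynomial (Fin 3) ℚ :=
  108 * (X 0) ^ 5 * X 2 - 135 * (X 0) ^ 4 * (X 1) ^ 2 + 90 * (X 0) ^ 2 * X 1 * (X 2) ^ 2
    - 320 * X 0 * (X 1) ^ 3 * X 2 + 256 * (X 1) ^ 5 + (X 2) ^ 4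

/-- `P = 12³X⁵ + 12⁻³Y³ − 12⁻³W²`. -/
noncomputable def PP : MvPolynomial (Fin 3) ℚ :=
  C ((12 : ℚ) ^ 3) * XX ^ 5 + C (((12 : ℚ) ^ 3)⁻¹) * YY ^ 3
    - C (((12 : ℚ) ^ 3)⁻¹) * WW ^ 2

/-- `Q = (−8a⁵c − 40a⁴b² + 10a²bc² + 45ab³c − 81b⁵ − c⁴)·(64a¹⁰ + 40a⁷bc − 160a⁶b³ + a⁵c³
  − 5a⁴b²c² + 5a³b⁴c − 25a²b⁶ − b⁵c²)`. -/
noncomputable def QQ : MvPolynomial (Fin 3) ℚ :=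
  (-8 * (X 0) ^ 5 * X 2 - 40 * (X 0) ^ 4 * (X 1) ^ 2 + 10 * (X 0) ^ 2 * X 1 * (X 2) ^ 2
      + 45 * X 0 * (X 1) ^ 3 * X 2 - 81 * (X 1) ^ 5 - (X 2) ^ 4) *
    (64 * (X 0) ^ 10 + 40 * (X 0) ^ 7 * X 1 * X 2 - 160 * (X 0) ^ 6 * (X 1) ^ 3
      + (X 0) ^ 5 * (X 2) ^ 3 - 5 * (X 0) ^ 4 * (X 1) ^ 2 * (X 2) ^ 2
      + 5 * (X 0) ^ 3 * (X 1) ^ 4 * X 2 - 25 * (X 0) ^ 2 * (X 1) ^ 6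
      - (X 1) ^ 5 * (X 2) ^ 2)

theorem aux (a b c x y w d q k : MvPolynomial (Fin 3) ℚ) (hk : 1728 * k = 1)
    (hx : x = a ^ 4 - b ^ 3 + a * b * c)
    (hy : y = c ^ 4 + 40 * a ^ 2 * b * c ^ 2 - 192 * a ^ 5 * c
      - 120 * a * b ^ 3 * c + 640 * a ^ 4 * b ^ 2 - 144 * b ^ 5)
    (hw : w = c ^ 6 + 60 * a ^ 2 * b * c ^ 4 + 576 * a ^ 5 * c ^ 3
      - 180 * a * b ^ 3 * c ^ 3 + 648 * b ^ 5 * c ^ 2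
      - 2760 * a ^ 4 * b ^ 2 * c ^ 2 + 7200 * a ^ 7 * b * c
      - 1728 * a ^ 10 + 9360 * a ^ 3 * b ^ 4 * c
      - 2080 * a ^ 6 * b ^ 3 - 16200 * a ^ 2 * b ^ 6)
    (hd : d = 108 * a ^ 5 * c - 135 * a ^ 4 * b ^ 2 + 90 * a ^ 2 * b * c ^ 2
      - 320 * a * b ^ 3 * c + 256 * b ^ 5 + c ^ 4)
    (hq : q = (-8 * a ^ 5 * c - 40 * a ^ 4 * b ^ 2 + 10 * a ^ 2 * b * c ^ 2
      + 45 * a * b ^ 3 * c - 81 * b ^ 5 - c ^ 4) *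
    (64 * a ^ 10 + 40 * a ^ 7 * b * c - 160 * a ^ 6 * b ^ 3
      + a ^ 5 * c ^ 3 - 5 * a ^ 4 * b ^ 2 * c ^ 2
      + 5 * a ^ 3 * b ^ 4 * c - 25 * a ^ 2 * b ^ 6
      - b ^ 5 * c ^ 2)) :
    (1728 * x ^ 5 + k * y ^ 3 - k * w ^ 2) ^ 2 - 4 * x ^ 5 * y ^ 3 = d * q ^ 2 := by
  have key : (1728 ^ 2 * x ^ 5 + y ^ 3 - w ^ 2) ^ 2 - 4 * 1728 ^ 2 * x ^ 5 * y ^ 3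
      = 1728 ^ 2 * (d * q ^ 2) := by
    subst hx hy hw hd hq
    ring
  linear_combination k ^ 2 * key + (-(1728 * k + 1) * (1728 * x ^ 5) ^ 2 - 2 * 1728 * x ^ 5 * k * (y ^ 3 - w ^ 2) + 4 * (1728 * k + 1) * x ^ 5 * y ^ 3 + (1728 * k + 1) * d * q ^ 2) * hk

/-- `P² − 4X⁵Y³ = D·Q²` in `ℚ[a,b,c]`. -/
theorem P_sq_sub_four_X5Y3 : PP ^ 2 - 4 * XX ^ 5 * YY ^ 3 = DD * QQ ^ 2 := by
  have hk : (1728 : MvPolynomial (Fin 3) ℚ) * C (((12 : ℚ) ^ 3)⁻¹) = 1 := by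
    rw [show (1728 : MvPolynomial (Fin 3) ℚ) = C (1728 : ℚ) from (map_ofNat C 1728).symm,
      ← C_mul, ← C_1]
    norm_num
  have h12 : C ((12 : ℚ) ^ 3) = (1728 : MvPolynomial (Fin 3) ℚ) := by
    rw [show (1728 : MvPolynomial (Fin 3) ℚ) = C (1728 : ℚ) from (map_ofNat C 1728).symm]
    norm_num
  rw [PP, h12]
  exact aux (X 0) (X 1) (X 2) XX YY WW DD QQ _ hk rfl rfl rfl rfl rfl

end Stmt11
end

section
/- Let ε = e^{2πi/5} ∈ ℂ. In ℂ[λ₁,λ₂,μ₁,μ₂], let y_ν = ε^{4ν}λ₁μ₁ − ε^{3ν}λ₂μ₁ + ε^{2ν}λ₁μ₂ + ε^{ν}λ₂μ₂, let H(z₁,z₂) = −(z₁²⁰ + z₂²⁰) + 228(z₁¹⁵z₂⁵ − z₁⁵z₂¹⁵) − 494z₁¹⁰z₂¹⁰, N₁ = (7λ₁⁵λ₂² + λ₂⁷)μ₁ + (−λ₁⁷ + 7λ₁²λ₂⁵)μ₂, M₁ = (λ₁¹³ − 39λ₁⁸λ₂⁵ − 26λ₁³λ₂¹⁰)μ₁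 + (−26λ₁¹⁰λ₂³ + 39λ₁⁵λ₂⁸ + λ₂¹³)μ₂, B(z₁,z₂) = −z₂⁸ − z₁z₂⁷ − 7(z₁²z₂⁶ − z₁³z₂⁵ + z₁⁵z₂³ + z₁⁶z₂²) + z₁⁷z₂ − z₁⁸, and D̃(z₁,z₂) = −z₁⁶ − 2z₁⁵z₂ + 5z₁⁴z₂² + 5z₁²z₂⁴ + 2z₁z₂⁵ − z₂⁶. Then for each ν ∈ {0,1,2,3,4}: H(λ₁,λ₂)·y_ν = ε^{ν}·B(ε^{ν}λ₁, λ₂)·M₁ + ε^{3ν}·B(ε^{ν}λ₁, λ₂)·D̃(ε^{ν}λ₁, λ₂)·N₁. -/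
open Complex MvPolynomial

namespace Stmt13

/-- The degree-20 icosahedral invariant form `H`. -/
def icosH {R : Type*} [CommRing R] (a b : R) : R :=
  -(a ^ 20 + b ^ 20) + 228 * (a ^ 15 * b ^ 5 - a ^ 5 * b ^ 15) - 494 * a ^ 10 * b ^ 10

/-- The cube-vertex form `B`. -/
def cubeB {R : Type*} [CommRing R] (a b : R) : R :=
  -b ^ 8 - a * b ^ 7 - 7 * (a ^ 2 * b ^ 6 - a ^ 3 * b ^ 5 + a ^ 5 * b ^ 3 + a ^ 6 * b ^ 2)
    + a ^ 7 * b - a ^ 8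

/-- The cube-face-centre form `D̃`. -/
def cubeD {R : Type*} [CommRing R] (a b : R) : R :=
  -a ^ 6 - 2 * a ^ 5 * b + 5 * a ^ 4 * b ^ 2 + 5 * a ^ 2 * b ^ 4 + 2 * a * b ^ 5 - b ^ 6

/-- The invariant form `N₁` (variables `X 0 = λ₁`, `X 1 = λ₂`, `X 2 = μ₁`, `X 3 = μ₂`). -/
noncomputable def N₁ : MvPolynomial (Fin 4) ℂ :=
  (7 * (X 0) ^ 5 * (X 1) ^ 2 + (X 1) ^ 7) * X 2
    + (-(X 0) ^ 7 + 7 * (X 0) ^ 2 * (X 1) ^ 5) * X 3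

/-- The invariant form `M₁`. -/
noncomputable def M₁ : MvPolynomial (Fin 4) ℂ :=
  ((X 0) ^ 13 - 39 * (X 0) ^ 8 * (X 1) ^ 5 - 26 * (X 0) ^ 3 * (X 1) ^ 10) * X 2
    + (-26 * (X 0) ^ 10 * (X 1) ^ 3 + 39 * (X 0) ^ 5 * (X 1) ^ 8 + (X 1) ^ 13) * X 3

/-- The root forms `y_ν = ε^{4ν}λ₁μ₁ − ε^{3ν}λ₂μ₁ + ε^{2ν}λ₁μ₂ + ε^{ν}λ₂μ₂`. -/
noncomputable def rootY (ν : Fin 5) : MvPolynomial (Fin 4) ℂ :=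
  C (exp (2 * Real.pi * I / 5) ^ (4 * (ν : ℕ))) * X 0 * X 2
    - C (exp (2 * Real.pi * I / 5) ^ (3 * (ν : ℕ))) * X 1 * X 2
    + C (exp (2 * Real.pi * I / 5) ^ (2 * (ν : ℕ))) * X 0 * X 3
    + C (exp (2 * Real.pi * I / 5) ^ (ν : ℕ)) * X 1 * X 3

theorem key1 {R : Type*} [CommRing R] (a b : R) :
    icosH a b * (a - b) = cubeB a b * (a ^ 13 - 39 * a ^ 8 * b ^ 5 - 26 * a ^ 3 * b ^ 10)
      + cubeB a b * cubeD a b * (7 * a ^ 5 * b ^ 2 + b ^ 7) := by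
  unfold icosH cubeB cubeD
  ring

theorem key2 {R : Type*} [CommRing R] (a b : R) :
    icosH a b * (a + b) = cubeB a b * (-26 * a ^ 10 * b ^ 3 + 39 * a ^ 5 * b ^ 8 + b ^ 13)
      + cubeB a b * cubeD a b * (-a ^ 7 + 7 * a ^ 2 * b ^ 5) := by
  unfold icosH cubeB cubeD
  ring

theorem key {R : Type*} [CommRing R] (e x b m n : R) (he : e ^ 5 = 1) :
    icosH x b * (e ^ 4 * x * m - e ^ 3 * b * m + e ^ 2 * x * n + e * b * n) =
      e * cubeB (e * x) b *
        ((x ^ 13 - 39 * x ^ 8 * b ^ 5 - 26 * x ^ 3 * b ^ 10) * m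
          + (-26 * x ^ 10 * b ^ 3 + 39 * x ^ 5 * b ^ 8 + b ^ 13) * n)
      + e ^ 3 * cubeB (e * x) b * cubeD (e * x) b *
        ((7 * x ^ 5 * b ^ 2 + b ^ 7) * m + (-x ^ 7 + 7 * x ^ 2 * b ^ 5) * n) := by
  have h5 : (e * x) ^ 5 = x ^ 5 := by rw [mul_pow, he, one_mul]
  have h10 : (e * x) ^ 10 = x ^ 10 := by linear_combination ((e * x) ^ 5 + x ^ 5) * h5
  have h7 : (e * x) ^ 7 = e ^ 2 * x ^ 7 := by linear_combination (e * x) ^ 2 * h5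
  have h8 : (e * x) ^ 8 = e ^ 3 * x ^ 8 := by linear_combination (e * x) ^ 3 * h5
  have h13 : (e * x) ^ 13 = e ^ 3 * x ^ 13 := by linear_combination (e * x) ^ 3 * h10
  have hH : icosH (e * x) b = icosH x b := by
    have h15 : (e * x) ^ 15 = x ^ 15 := by linear_combination (e * x) ^ 5 * h10 + x ^ 10 * h5
    have h20 : (e * x) ^ 20 = x ^ 20 := by linear_combination ((e * x) ^ 10 + x ^ 10) * h10
    unfold icosH
    rw [h5, h10, h15, h20]
  have k1 := key1 (e * x) b
  have k2 := key2 (e * x) b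
  rw [hH, h13, h8, h5, mul_pow e x 3] at k1
  rw [hH, h10, h5, h7, mul_pow e x 2] at k2
  generalize cubeB (e * x) b = B at *
  generalize cubeD (e * x) b = D at *
  generalize icosH x b = H at *
  linear_combination e ^ 3 * m * k1 + e * n * k2
    + e * B * (x ^ 13 - 39 * x ^ 8 * b ^ 5 - 26 * x ^ 3 * b ^ 10) * m * he

/-- Rational expression of each root:
`H(λ₁,λ₂)·y_ν = ε^ν·B(ε^νλ₁,λ₂)·M₁ + ε^{3ν}·B(ε^νλ₁,λ₂)·D̃(ε^νλ₁,λ₂)·N₁`. -/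
theorem roots_formula (ν : Fin 5) :
    icosH (X 0 : MvPolynomial (Fin 4) ℂ) (X 1) * rootY ν =
      C (exp (2 * Real.pi * I / 5) ^ (ν : ℕ)) *
          cubeB (C (exp (2 * Real.pi * I / 5) ^ (ν : ℕ)) * X 0) (X 1) * M₁
        + C (exp (2 * Real.pi * I / 5) ^ (3 * (ν : ℕ))) *
            cubeB (C (exp (2 * Real.pi * I / 5) ^ (ν : ℕ)) * X 0) (X 1) *
            cubeD (C (exp (2 * Real.pi * I / 5) ^ (ν : ℕ)) * X 0) (X 1) * N₁ := by
  have he : exp (2 * Real.pi * I / 5) ^ 5 = 1 := by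
    rw [← Complex.exp_nat_mul]
    rw [show ((5 : ℕ) : ℂ) * (2 * Real.pi * I / 5) = 2 * Real.pi * I by push_cast; ring]
    exact Complex.exp_two_pi_mul_I
  have h := key (C (exp (2 * Real.pi * I / 5) ^ (ν : ℕ)) : MvPolynomial (Fin 4) ℂ)
    (X 0) (X 1) (X 2) (X 3) (by
      rw [← C_pow, ← pow_mul, mul_comm (ν : ℕ) 5, pow_mul, he, one_pow, C_1])
  unfold rootY M₁ N₁
  rw [mul_comm 4, mul_comm 3, mul_comm 2 (ν : ℕ), pow_mul _ _ 4, pow_mul _ _ 3, pow_mul _ _ 2,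
    C_pow _ 4, C_pow _ 3, C_pow _ 2]
  exact h

end Stmt13
end

section
/- Let H(z₁,z₂) = −(z₁²⁰ + z₂²⁰) + 228(z₁¹⁵z₂⁵ − z₁⁵z₂¹⁵) − 494z₁¹⁰z₂¹⁰, T(z₁,z₂) = (z₁³⁰ + z₂³⁰) + 522(z₁²⁵z₂⁵ − z₁⁵z₂²⁵) − 10005(z₁²⁰z₂¹⁰ + z₁¹⁰z₂²⁰), B(z₁,z₂) = −z₂⁸ − z₁z₂⁷ − 7(z₁²z₂⁶ − z₁³z₂⁵ + z₁⁵z₂³ + z₁⁶z₂²) + z₁⁷z₂ − z₁⁸, and D̃(z₁,z₂) = −z₁⁶ − 2z₁⁵z₂ + 5z₁⁴z₂² + 5z₁²z₂⁴ + 2z₁z₂⁵ − z₂⁶, all in ℤ[z₁,z₂]. Then B divides H, and D̃ divides T, in ℤ[z₁,z₂]. -/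
open MvPolynomial

namespace Stmt14

/-- The degree-20 icosahedral invariant `H`. -/
noncomputable def icosH : MvPolynomial (Fin 2) ℤ :=
  -((X 0) ^ 20 + (X 1) ^ 20) + 228 * ((X 0) ^ 15 * (X 1) ^ 5 - (X 0) ^ 5 * (X 1) ^ 15)
    - 494 * (X 0) ^ 10 * (X 1) ^ 10

/-- The degree-30 icosahedral invariant `T`. -/
noncomputable def icosT : MvPolynomial (Fin 2) ℤ :=
  ((X 0) ^ 30 + (X 1) ^ 30) + 522 * ((X 0) ^ 25 * (X 1) ^ 5 - (X 0) ^ 5 * (X 1) ^ 25)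
    - 10005 * ((X 0) ^ 20 * (X 1) ^ 10 + (X 0) ^ 10 * (X 1) ^ 20)

/-- The cube-vertex form `B`. -/
noncomputable def cubeB : MvPolynomial (Fin 2) ℤ :=
  -(X 1) ^ 8 - X 0 * (X 1) ^ 7
    - 7 * ((X 0) ^ 2 * (X 1) ^ 6 - (X 0) ^ 3 * (X 1) ^ 5 + (X 0) ^ 5 * (X 1) ^ 3
      + (X 0) ^ 6 * (X 1) ^ 2) + (X 0) ^ 7 * X 1 - (X 0) ^ 8

/-- The cube-face-centre form `D̃`. -/
noncomputable def cubeD : MvPolynomial (Fin 2) ℤ :=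
  -(X 0) ^ 6 - 2 * (X 0) ^ 5 * X 1 + 5 * (X 0) ^ 4 * (X 1) ^ 2
    + 5 * (X 0) ^ 2 * (X 1) ^ 4 + 2 * X 0 * (X 1) ^ 5 - (X 1) ^ 6

theorem auxB {R : Type*} [CommRing R] (x y : R) :
    (  -y ^ 8 - x * y ^ 7
    - 7 * (x ^ 2 * y ^ 6 - x ^ 3 * y ^ 5 + x ^ 5 * y ^ 3
      + x ^ 6 * y ^ 2) + x ^ 7 * y - x ^ 8) ∣
    (  -(x ^ 20 + y ^ 20) + 228 * (x ^ 15 * y ^ 5 - x ^ 5 * y ^ 15)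
    - 494 * x ^ 10 * y ^ 10) := by
  refine ⟨(1) * x ^ 12 * y ^ 0
    + (1) * x ^ 11 * y ^ 1
    + (-6) * x ^ 10 * y ^ 2
    + (-20) * x ^ 9 * y ^ 3
    + (15) * x ^ 8 * y ^ 4
    + (-24) * x ^ 7 * y ^ 5
    + (11) * x ^ 6 * y ^ 6
    + (24) * x ^ 5 * y ^ 7
    + (15) * x ^ 4 * y ^ 8
    + (20) * x ^ 3 * y ^ 9
    + (-6) * x ^ 2 * y ^ 10
    + (-1) * x ^ 1 * y ^ 11
    + (1) * x ^ 0 * y ^ 12, ?_⟩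
  ring

theorem auxD {R : Type*} [CommRing R] (x y : R) :
    (  -x ^ 6 - 2 * x ^ 5 * y + 5 * x ^ 4 * y ^ 2
    + 5 * x ^ 2 * y ^ 4 + 2 * x * y ^ 5 - y ^ 6) ∣
    (  (x ^ 30 + y ^ 30) + 522 * (x ^ 25 * y ^ 5 - x ^ 5 * y ^ 25)
    - 10005 * (x ^ 20 * y ^ 10 + x ^ 10 * y ^ 20)) := by
  refine ⟨(-1) * x ^ 24 * y ^ 0
    + (2) * x ^ 23 * y ^ 1
    + (-9) * x ^ 22 * y ^ 2
    + (28) * x ^ 21 * y ^ 3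
    + (-106) * x ^ 20 * y ^ 4
    + (-162) * x ^ 19 * y ^ 5
    + (-246) * x ^ 18 * y ^ 6
    + (-198) * x ^ 17 * y ^ 7
    + (-1299) * x ^ 16 * y ^ 8
    + (558) * x ^ 15 * y ^ 9
    + (946) * x ^ 14 * y ^ 10
    + (-422) * x ^ 13 * y ^ 11
    + (-1071) * x ^ 12 * y ^ 12
    + (422) * x ^ 11 * y ^ 13
    + (946) * x ^ 10 * y ^ 14
    + (-558) * x ^ 9 * y ^ 15
    + (-1299) * x ^ 8 * y ^ 16
    + (198) * x ^ 7 * y ^ 17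
    + (-246) * x ^ 6 * y ^ 18
    + (162) * x ^ 5 * y ^ 19
    + (-106) * x ^ 4 * y ^ 20
    + (-28) * x ^ 3 * y ^ 21
    + (-9) * x ^ 2 * y ^ 22
    + (-2) * x ^ 1 * y ^ 23
    + (-1) * x ^ 0 * y ^ 24, ?_⟩
  ring

/-- `B` divides `H` and `D̃` divides `T` in `ℤ[z₁,z₂]`. -/
theorem cubeB_dvd_icosH_and_cubeD_dvd_icosT : cubeB ∣ icosH ∧ cubeD ∣ icosT := by
  exact ⟨auxB (X 0) (X 1), auxD (X 0) (X 1)⟩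

end Stmt14
end

section
/- In the ring ℚ⟦X⟧ of formal power series, let Y = Σ_{k≥0} (C(5k,k)/(4k+1))·X^{4k+1}, where C(5k,k) denotes the binomial coefficient. Then Y⁵ − Y + X = 0. -/
open PowerSeries

/-- Fuss–Catalan (Raney) numbers, by recursion. -/
def raneyA : ℕ → ℕ → ℚ
  | 0, _ => 1
  | _ + 1, 0 => 0
  | k + 1, r + 1 => raneyA (k + 1) r + raneyA k (r + 5)

theorem raneyA_closed (k r : ℕ) :
    ((r : ℚ) + 5 * k) * raneyA k r = r * (Nat.choose (r + 5 * k) k : ℚ) := by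
  induction k generalizing r with
  | zero => simp [raneyA]
  | succ k ihk =>
    induction r with
    | zero => simp [raneyA]
    | succ r ihr =>
      have h1 := ihk (r + 5)
      have e1 : r + 5 + 5 * k = r + 5 * (k + 1) := by ring
      have e2 : r + 1 + 5 * (k + 1) = (r + 5 * (k + 1)) + 1 := by ring
      rw [e1] at h1
      rw [e2]
      have c1 : ((r + 5 * (k + 1) + 1 : ℕ) : ℚ) * (Nat.choose (r + 5 * (k + 1)) k : ℚ)
          = (Nat.choose (r + 5 * (k + 1) + 1) (k + 1) : ℚ) * ((k + 1 : ℕ) : ℚ) := by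
        exact_mod_cast Nat.add_one_mul_choose_eq (r + 5 * (k + 1)) k
      have c2 : (Nat.choose (r + 5 * (k + 1) + 1) (k + 1) : ℚ)
          = Nat.choose (r + 5 * (k + 1)) k + Nat.choose (r + 5 * (k + 1)) (k + 1) := by
        exact_mod_cast Nat.choose_succ_succ (r + 5 * (k + 1)) k
      rw [raneyA]
      generalize (Nat.choose (r + 5 * (k + 1) + 1) (k + 1) : ℚ) = c at *
      generalize (Nat.choose (r + 5 * (k + 1)) (k + 1) : ℚ) = d at *
      generalize (Nat.choose (r + 5 * (k + 1)) k : ℚ) = e at *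
      generalize raneyA (k + 1) r = a at *
      generalize raneyA k (r + 5) = b at *
      push_cast at *
      have hN : (r : ℚ) + 5 * (k + 1) ≠ 0 := by positivity
      have hd : d = c - e := by linarith
      subst hd
      apply mul_left_cancel₀ hN
      linear_combination ((r : ℚ) + 1 + 5 * (k + 1)) * (ihr + h1) + 5 * c1

/-- Generating series. -/
noncomputable def raneyS (r : ℕ) : PowerSeries ℚ := PowerSeries.mk fun k => raneyA k r

theorem raneyS_zero : raneyS 0 = 1 := by
  ext k
  cases k <;> simp [raneyS, raneyA, PowerSeries.coeff_one]

theorem raneyS_succ (r : ℕ) : raneyS (r + 1) = raneyS r + X * raneyS (r + 5) := by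
  ext k
  cases k <;> simp [raneyS, raneyA, PowerSeries.coeff_succ_X_mul]

theorem raneyS_mul (r s : ℕ) : raneyS r * raneyS s = raneyS (r + s) := by
  ext k
  induction k generalizing r with
  | zero =>
    simp [raneyS, raneyA]
  | succ k ihk =>
    induction r with
    | zero => simp [raneyS_zero]
    | succ r ihr =>
      rw [raneyS_succ, add_mul, map_add, ihr, mul_assoc, PowerSeries.coeff_succ_X_mul, ihk,
        show r + 1 + s = (r + s) + 1 by ring, raneyS_succ, map_add, PowerSeries.coeff_succ_X_mul,
        show r + 5 + s = r + s + 5 by ring]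

theorem raneyS_eq : raneyS 1 = 1 + X * raneyS 1 ^ 5 := by
  have h : raneyS 1 ^ 5 = raneyS 5 := by
    simp only [pow_succ, pow_zero, one_mul, raneyS_mul]
  rw [h]
  have := raneyS_succ 0
  rwa [raneyS_zero] at this

/-- The Lambert–Eisenstein series `Y = Σ_{k≥0} C(5k,k)/(4k+1) · X^{4k+1}` satisfies
`Y⁵ − Y + X = 0` in `ℚ⟦X⟧`. -/
theorem lambert_eisenstein_series :
    letI Y : PowerSeries ℚ := PowerSeries.mk fun n =>
      if n % 4 = 1 then (Nat.choose (5 * (n / 4)) (n / 4) : ℚ) / (n : ℚ) else 0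
    Y ^ 5 - Y + PowerSeries.X = 0 := by
  set Y : PowerSeries ℚ := PowerSeries.mk fun n =>
      if n % 4 = 1 then (Nat.choose (5 * (n / 4)) (n / 4) : ℚ) / (n : ℚ) else 0 with hYdef
  have hY : Y = X * PowerSeries.expand 4 (by norm_num) (raneyS 1) := by
    ext n
    cases n with
    | zero => simp [Y]
    | succ n =>
      rw [PowerSeries.coeff_succ_X_mul, PowerSeries.coeff_expand]
      simp only [Y, PowerSeries.coeff_mk, raneyS]
      by_cases h : 4 ∣ n
      · obtain ⟨k, rfl⟩ := h
        have h1 : (4 * k + 1) % 4 = 1 := by omega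
        have h2 : (4 * k + 1) / 4 = k := by omega
        have h3 : 4 * k / 4 = k := by omega
        rw [if_pos h1, if_pos (Dvd.intro _ rfl), h2, h3]
        have hc := raneyA_closed k 1
        have c : (Nat.choose (1 + 5 * k) k : ℚ) * (4 * k + 1)
            = Nat.choose (5 * k) k * (5 * k + 1) := by
          have := Nat.choose_mul_succ_eq (5 * k) k
          rw [show 5 * k + 1 - k = 4 * k + 1 by omega, add_comm (5 * k) 1] at this
          have t : (Nat.choose (5 * k) k : ℚ) * (1 + 5 * k)
            = Nat.choose (1 + 5 * k) k * (4 * k + 1) := by exact_mod_cast this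
          linarith
        have p1 : (4 * (k : ℚ) + 1) ≠ 0 := by positivity
        have p2 : (5 * (k : ℚ) + 1) ≠ 0 := by positivity
        push_cast at *
        rw [div_eq_iff p1]
        apply mul_left_cancel₀ p2
        linear_combination -c - (4 * (k : ℚ) + 1) * hc
      · rw [if_neg h, if_neg (by omega)]
  have hE := congrArg (PowerSeries.expand 4 (by norm_num)) raneyS_eq
  simp only [map_add, map_mul, map_pow, map_one, PowerSeries.expand_X] at hE
  rw [hY]
  linear_combination (-X : PowerSeries ℚ) * hE
end

section
/- Let a, b, c ∈ ℂ and let U ⊆ ℂ be an open set with 0 ∉ U and 1 ∉ U. Suppose f, g : ℂ → ℂ are analytic on U and each satisfies the hypergeometric differential equation z(1−z)y''(z) + (c − (a+b+1)z)y'(z) − ab·y(z) = 0 on U, and suppose that g(z) ≠ 0 and the Wronskian f'(z)g(z) − f(z)g'(z) ≠ 0 for all z ∈ U. Let s = f/g and let 𝒮s = (s''/s')' − (1/2)(s''/s')² denote its Schwarzian derivative. Then for all z ∈ U: 𝒮s(z) = (1 − (c−a−b)²)/(2(1−z)²) + (1 − (1−c)²)/(2z²) + (1 − (c−a−b)² −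 (1−c)² + (a−b)²)/(2z(1−z)). -/
/-- A ratio `s = f/g` of two solutions of the hypergeometric differential equation with
parameters `a, b, c` satisfies the Schwarzian differential equation
`𝒮s = (1−(c−a−b)²)/(2(1−z)²) + (1−(1−c)²)/(2z²) + (1−(c−a−b)²−(1−c)²+(a−b)²)/(2z(1−z))`. -/
theorem schwarzian_of_hypergeometric_ratio (a b c : ℂ) (U : Set ℂ) (hU : IsOpen U)
    (h0 : (0 : ℂ) ∉ U) (h1 : (1 : ℂ) ∉ U) (f g : ℂ → ℂ)
    (hf : AnalyticOnNhd ℂ f U) (hg : AnalyticOnNhd ℂ g U)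
    (hfode : ∀ z ∈ U, z * (1 - z) * deriv (deriv f) z
      + (c - (a + b + 1) * z) * deriv f z - a * b * f z = 0)
    (hgode : ∀ z ∈ U, z * (1 - z) * deriv (deriv g) z
      + (c - (a + b + 1) * z) * deriv g z - a * b * g z = 0)
    (hgne : ∀ z ∈ U, g z ≠ 0)
    (hW : ∀ z ∈ U, deriv f z * g z - f z * deriv g z ≠ 0) :
    ∀ z ∈ U,
      letI s : ℂ → ℂ := fun w => f w / g w
      deriv (fun w => deriv (deriv s) w / deriv s w) z
          - (1 / 2) * (deriv (deriv s) z / deriv s z) ^ 2 =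
        (1 - (c - a - b) ^ 2) / (2 * (1 - z) ^ 2) + (1 - (1 - c) ^ 2) / (2 * z ^ 2)
          + (1 - (c - a - b) ^ 2 - (1 - c) ^ 2 + (a - b) ^ 2) / (2 * z * (1 - z)) := by
  intro z hz
  have key : ∀ w ∈ U, HasDerivAt (fun w => f w / g w)
      ((deriv f w * g w - f w * deriv g w) / g w ^ 2) w := fun w hw =>
    (hf w hw).differentiableAt.hasDerivAt.div (hg w hw).differentiableAt.hasDerivAt (hgne w hw)
  have nz : ∀ w ∈ U, w ≠ 0 := fun w hw h => h0 (h ▸ hw)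
  have nz1 : ∀ w ∈ U, 1 - w ≠ 0 := fun w hw h => h1 ((sub_eq_zero.mp h) ▸ hw)
  have key2 : ∀ w ∈ U, deriv (deriv (fun w => f w / g w)) w =
      (-((c - (a + b + 1) * w) / (w * (1 - w))) - 2 * (deriv g w / g w)) *
        deriv (fun w => f w / g w) w := by
    intro w hw
    have e : deriv (fun w => f w / g w) =ᶠ[nhds w]
        fun w => (deriv f w * g w - f w * deriv g w) / g w ^ 2 := by
      filter_upwards [hU.mem_nhds hw] with x hx using (key x hx).deriv
    have Hf := (hf w hw).differentiableAt.hasDerivAt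
    have Hg := (hg w hw).differentiableAt.hasDerivAt
    have Hf' := (hf w hw).deriv.differentiableAt.hasDerivAt
    have Hg' := (hg w hw).deriv.differentiableAt.hasDerivAt
    have hgw := hgne w hw
    have H := ((Hf'.mul Hg).sub (Hf.mul Hg')).div (Hg.pow 2) (pow_ne_zero 2 hgw)
    have H2 : deriv (fun w => (deriv f w * g w - f w * deriv g w) / g w ^ 2) w = _ := H.deriv
    rw [e.deriv_eq, H2, (key w hw).deriv]
    have w0 := nz w hw
    have w1 := nz1 w hw
    have ef : deriv (deriv f) w =
        (a * b * f w - (c - (a + b + 1) * w) * deriv f w) / (w * (1 - w)) := by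
      rw [eq_div_iff (mul_ne_zero w0 w1)]
      linear_combination hfode w hw
    have eg : deriv (deriv g) w =
        (a * b * g w - (c - (a + b + 1) * w) * deriv g w) / (w * (1 - w)) := by
      rw [eq_div_iff (mul_ne_zero w0 w1)]
      linear_combination hgode w hw
    simp only [Pi.mul_apply, Pi.sub_apply, Pi.pow_apply]
    rw [ef, eg]
    field_simp
    push_cast
    ring
  have key3 : ∀ w ∈ U, deriv (deriv (fun w => f w / g w)) w / deriv (fun w => f w / g w) w =
      -((c - (a + b + 1) * w) / (w * (1 - w))) - 2 * (deriv g w / g w) := by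
    intro w hw
    rw [key2 w hw, mul_div_assoc, div_self, mul_one]
    rw [(key w hw).deriv]
    exact div_ne_zero (hW w hw) (pow_ne_zero 2 (hgne w hw))
  have e : (fun w => deriv (deriv (fun w => f w / g w)) w / deriv (fun w => f w / g w) w)
      =ᶠ[nhds z] fun w => -((c - (a + b + 1) * w) / (w * (1 - w))) - 2 * (deriv g w / g w) := by
    filter_upwards [hU.mem_nhds hz] with x hx using key3 x hx
  have z0 := nz z hz
  have z1 := nz1 z hz
  have hgz := hgne z hz
  have Hg := (hg z hz).differentiableAt.hasDerivAt
  have Hg' := (hg z hz).deriv.differentiableAt.hasDerivAt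
  have A1 : HasDerivAt (fun w : ℂ => c - (a + b + 1) * w) (-((a + b + 1) * 1)) z :=
    ((hasDerivAt_id' z).const_mul (a + b + 1)).const_sub c
  have A2 : HasDerivAt (fun w : ℂ => w * (1 - w)) (1 * (1 - z) + z * (-1)) z :=
    (hasDerivAt_id' z).mul ((hasDerivAt_id' z).const_sub 1)
  have H := ((A1.div A2 (mul_ne_zero z0 z1)).neg).sub ((Hg'.div Hg hgz).const_mul 2)
  have H2 : deriv (fun w => -((c - (a + b + 1) * w) / (w * (1 - w)))
      - 2 * (deriv g w / g w)) z = _ := H.deriv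
  have eg : deriv (deriv g) z =
      (a * b * g z - (c - (a + b + 1) * z) * deriv g z) / (z * (1 - z)) := by
    rw [eq_div_iff (mul_ne_zero z0 z1)]
    linear_combination hgode z hz
  show deriv (fun w => deriv (deriv (fun w => f w / g w)) w / deriv (fun w => f w / g w) w) z
    - (1 / 2) * (deriv (deriv (fun w => f w / g w)) z / deriv (fun w => f w / g w) z) ^ 2 = _
  rw [e.deriv_eq, key3 z hz, H2, eg]
  field_simp
  ring
end
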